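/- Let A be the 5×5 reciprocal matrix with rows (1, 1, a_13, a_14, 1), (1, 1, 1, a_24, 1), (1/a_13, 1, 1, 1, 1), (1/a_14, 1/a_24, 1, 1, 1), (1, 1, 1, 1, 1), where a_13, a_24 > 0 and a_14 ≥ 1. Suppose that neither (1 < a_24 < a_14 < a_13) nor (a_24 < 1 < a_13 < a_14) holds. Then C(A) ⊆ E(A). -/

import Mathlib

open Matrix

/-- An `n × n` real matrix is *reciprocal* if all its entries are positive and
`A j i = 1 / A i j` for all `i, j`. -/
def IsReciprocal {n : ℕ} (A : Matrix (Fin n) (Fin n) ℝ) : Prop :=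
  (∀ i j, 0 < A i j) ∧ ∀ i j, A j i = 1 / A i j

/-- A positive vector `w` is *efficient* for `A` if every positive vector `v` whose
associated consistent matrix approximates `A` at least as well entrywise is
proportional to `w`. -/
def IsEfficient {n : ℕ} (A : Matrix (Fin n) (Fin n) ℝ) (w : Fin n → ℝ) : Prop :=
  (∀ i, 0 < w i) ∧
    ∀ v : Fin n → ℝ, (∀ i, 0 < v i) →
      (∀ i j, |A i j - v i / v j| ≤ |A i j - w i / w j|) → ∃ c : ℝ, v = c • w

/-- The set of efficient vectors for `A`. -/
def EffSet {n : ℕ} (A : Matrix (Fin n) (Fin n) ℝ) : Set (Fin n → ℝ) :=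
  {w | IsEfficient A w}

/-- The cone generated by the columns of `A`: nonzero vectors of the form `A · u`
with `u` entrywise nonnegative. -/
def ConeCols {n : ℕ} (A : Matrix (Fin n) (Fin n) ℝ) : Set (Fin n → ℝ) :=
  {w | w ≠ 0 ∧ ∃ u : Fin n → ℝ, (∀ i, 0 ≤ u i) ∧ w = A.mulVec u}

/-- A *monomial* matrix: the product of a permutation matrix and a diagonal matrix
with positive diagonal entries. -/
def IsMonomial {n : ℕ} (S : Matrix (Fin n) (Fin n) ℝ) : Prop :=
  ∃ (σ : Equiv.Perm (Fin n)) (d : Fin n → ℝ), (∀ i, 0 < d i) ∧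
    S = σ.permMatrix ℝ * Matrix.diagonal d

/-- If `w i / w j` is at least `x` and `v` approximates at least as well, the ratio decreases. -/
theorem edge_le (x vi vj wi wj : ℝ) (hvi : 0 < vi) (hvj : 0 < vj) (hwi : 0 < wi) (hwj : 0 < wj)
    (h : |x - vi / vj| ≤ |x - wi / wj|) (hw : x * wj ≤ wi) : vi / wi ≤ vj / wj := by
  have h1 : x ≤ wi / wj := by rwa [le_div_iff₀ hwj]
  have h2 : vi / vj ≤ wi / wj := by
    rw [abs_of_nonpos (by linarith : x - wi / wj ≤ 0)] at h
    have := neg_abs_le (x - vi / vj)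
    linarith
  rw [div_le_div_iff₀ hvj hwj] at h2
  rw [div_le_div_iff₀ hwi hwj]
  linarith

set_option maxHeartbeats 4000000 in
/-- Combinatorial core: the comparison relations force all ratios to be equal. -/
theorem core_eq (a b c p q r u1 u2 u3 u4 u5 t1 t2 t3 t4 t5 : ℝ)
    (ha : 0 < a) (hc : 0 < c) (hb : 1 ≤ b) (hp : a * p = 1) (hq : b * q = 1) (hr : c * r = 1)
    (hcond : ¬ (1 < c ∧ c < b ∧ b < a) ∧ ¬ (c < 1 ∧ 1 < a ∧ a < b))
    (h1 : 0 ≤ u1) (h2 : 0 ≤ u2) (h3 : 0 ≤ u3) (h4 : 0 ≤ u4) (h5 : 0 ≤ u5)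
    (e12 : 0 ≤ (a - 1) * u3 + (b - c) * u4 → t1 ≤ t2)
    (e21 : (a - 1) * u3 + (b - c) * u4 ≤ 0 → t2 ≤ t1)
    (e13 : 0 ≤ (1 - a) * u2 + (b - a) * u4 + (1 - a) * u5 → t1 ≤ t3)
    (e31 : (1 - a) * u2 + (b - a) * u4 + (1 - a) * u5 ≤ 0 → t3 ≤ t1)
    (e41 : (1 - b * r) * u2 + (a - b) * u3 + (1 - b) * u5 ≤ 0 → t4 ≤ t1)
    (e15 : 0 ≤ (a - 1) * u3 + (b - 1) * u4 → t1 ≤ t5)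
    (e23 : 0 ≤ (1 - p) * u1 + (c - 1) * u4 → t2 ≤ t3)
    (e32 : (1 - p) * u1 + (c - 1) * u4 ≤ 0 → t3 ≤ t2)
    (e24 : 0 ≤ (1 - c * q) * u1 + (1 - c) * u3 + (1 - c) * u5 → t2 ≤ t4)
    (e42 : (1 - c * q) * u1 + (1 - c) * u3 + (1 - c) * u5 ≤ 0 → t4 ≤ t2)
    (e25 : 0 ≤ (c - 1) * u4 → t2 ≤ t5)
    (e52 : (c - 1) * u4 ≤ 0 → t5 ≤ t2)
    (e34 : 0 ≤ (p - q) * u1 + (1 - r) * u2 → t3 ≤ t4)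
    (e43 : (p - q) * u1 + (1 - r) * u2 ≤ 0 → t4 ≤ t3)
    (e35 : 0 ≤ (p - 1) * u1 → t3 ≤ t5)
    (e53 : (p - 1) * u1 ≤ 0 → t5 ≤ t3)
    (e54 : (q - 1) * u1 + (r - 1) * u2 ≤ 0 → t5 ≤ t4) :
    t1 = t5 ∧ t2 = t5 ∧ t3 = t5 ∧ t4 = t5 := by
  have hb0 : 0 < b := by linarith
  have hp0 : 0 < p := by by_contra hh; push Not at hh; nlinarith
  have hq0 : 0 < q := by by_contra hh; push Not at hh; nlinarith
  have hr0 : 0 < r := by by_contra hh; push Not at hh; nlinarith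
  have hq1 : q ≤ 1 := by nlinarith
  have s : ∀ x y : ℝ, 0 ≤ y → (0 ≤ x → 0 ≤ x * y) ∧ (x ≤ 0 → x * y ≤ 0) := fun x y hy =>
    ⟨fun hx => mul_nonneg hx hy, fun hx => mul_nonpos_of_nonpos_of_nonneg hx hy⟩
  rcases le_total 1 a with a1 | a1
  · have p1 : p ≤ 1 := by nlinarith
    rcases le_total 1 c with c1 | c1
    · have r1 : r ≤ 1 := by nlinarith
      have f15 := e15 (by nlinarith [(s (a-1) u3 h3).1, (s (b-1) u4 h4).1])
      have f25 := e25 ((s _ u4 h4).1 (by linarith))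
      have f53 := e53 ((s _ u1 h1).2 (by linarith))
      have f54 := e54 (by linarith [(s (q-1) u1 h1).2 (by linarith), (s (r-1) u2 h2).2 (by linarith)])
      rcases le_total b a with ab | ab
      · have pq : p ≤ q := by
          by_contra hh
          push Not at hh
          nlinarith [mul_pos hb0 (sub_pos.2 hh), mul_nonneg hp0.le (sub_nonneg.2 ab)]
        have f31 := e31 (by linarith [(s (1-a) u2 h2).2 (by linarith), (s (b-a) u4 h4).2 (by linarith), (s (1-a) u5 h5).2 (by linarith)])
        rcases le_total c b with cb | cb
        · have f12 := e12 (by linarith [(s (a-1) u3 h3).1 (by linarith), (s (b-c) u4 h4).1 (by linarith)])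
          rcases eq_or_lt_of_le c1 with hc1 | hc1
          · have f43 := e43 (by
              have : r = 1 := by rw [← hc1] at hr; linarith
              rw [this]
              linarith [(s (p-q) u1 h1).2 (by linarith)])
            refine ⟨?_, ?_, ?_, ?_⟩ <;> linarith
          · rcases eq_or_lt_of_le cb with hcb | hcb
            · have f42 := e42 (by
                rw [hcb, hq]
                linarith [(s (1-b) u3 h3).2 (by linarith), (s (1-b) u5 h5).2 (by linarith)])
              refine ⟨?_, ?_, ?_, ?_⟩ <;> linarith
            · have hab : a = b := by
                by_contra hne
                exact hcond.1 ⟨hc1, hcb, lt_of_le_of_ne ab (Ne.symm hne)⟩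
              have f41 := e41 (by
                have : 1 ≤ b * r := by nlinarith
                linarith [(s (1-b*r) u2 h2).2 (by linarith), (s (a-b) u3 h3).2 (by linarith), (s (1-b) u5 h5).2 (by linarith)])
              refine ⟨?_, ?_, ?_, ?_⟩ <;> linarith
        · have f42 := e42 (by
            have : 1 ≤ c * q := by nlinarith
            linarith [(s (1-c*q) u1 h1).2 (by linarith), (s (1-c) u3 h3).2 (by linarith), (s (1-c) u5 h5).2 (by linarith)])
          refine ⟨?_, ?_, ?_, ?_⟩ <;> linarith
      · have pq : q ≤ p := by
          by_contra hh
          push Not at hh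
          nlinarith [mul_pos ha (sub_pos.2 hh), mul_nonneg hq0.le (sub_nonneg.2 ab)]
        have f34 := e34 (by linarith [(s (p-q) u1 h1).1 (by linarith), (s (1-r) u2 h2).1 (by linarith)])
        rcases le_total c b with cb | cb
        · have f12 := e12 (by linarith [(s (a-1) u3 h3).1 (by linarith), (s (b-c) u4 h4).1 (by linarith)])
          have f41 := e41 (by
            have : 1 ≤ b * r := by nlinarith
            linarith [(s (1-b*r) u2 h2).2 (by linarith), (s (a-b) u3 h3).2 (by linarith), (s (1-b) u5 h5).2 (by linarith)])
          refine ⟨?_, ?_, ?_, ?_⟩ <;> linarith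
        · have f42 := e42 (by
            have : 1 ≤ c * q := by nlinarith
            linarith [(s (1-c*q) u1 h1).2 (by linarith), (s (1-c) u3 h3).2 (by linarith), (s (1-c) u5 h5).2 (by linarith)])
          have key : t2 ≤ t1 ∨ t3 ≤ t1 ∨ t4 ≤ t1 := by
            by_contra hh
            push Not at hh
            obtain ⟨n2, n3, n4⟩ := hh
            have m2 : 0 < (a - 1) * u3 + (b - c) * u4 := by
              by_contra hx
              exact absurd (e21 (not_lt.1 hx)) (not_le.2 n2)
            have m3 : 0 < (1 - a) * u2 + (b - a) * u4 + (1 - a) * u5 := by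
              by_contra hx
              exact absurd (e31 (not_lt.1 hx)) (not_le.2 n3)
            have m4 : 0 < (1 - b * r) * u2 + (a - b) * u3 + (1 - b) * u5 := by
              by_contra hx
              exact absurd (e41 (not_lt.1 hx)) (not_le.2 n4)
            have g3 : (a - 1) * u2 < (b - a) * u4 := by
              linarith [(s (1-a) u5 h5).2 (by linarith)]
            have g4 : (b - a) * u3 < (1 - b * r) * u2 := by
              linarith [(s (1-b) u5 h5).2 (by linarith)]
            have g4' : c * ((b - a) * u3) < (c - b) * u2 := by
              have := mul_lt_mul_of_pos_left g4 hc
              have e : c * ((1 - b * r) * u2) = (c - b) * u2 := by linear_combination (-b * u2) * hr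
              linarith
            have g4'' : (b - a) * u3 < (c - b) * u2 := by
              nlinarith [mul_nonneg (sub_nonneg.2 ab) h3]
            have k1 : 0 < a - 1 := by
              rcases eq_or_lt_of_le a1 with h | h
              · rw [← h] at m2
                linarith [(s (b-c) u4 h4).2 (by linarith)]
              · linarith
            have z1 := mul_lt_mul_of_pos_left g4'' k1
            have z2 := mul_le_mul_of_nonneg_left g3.le (sub_nonneg.2 cb)
            have z3 := mul_le_mul_of_nonneg_left m2.le (sub_nonneg.2 ab)
            linarith
          rcases key with k | k | k <;> refine ⟨?_, ?_, ?_, ?_⟩ <;> linarith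
    · rcases eq_or_lt_of_le c1 with hc1 | hc1
      · subst hc1
        have hr1 : r = 1 := by linarith
        subst hr1
        have f15 := e15 (by linarith [(s (a-1) u3 h3).1 (by linarith), (s (b-1) u4 h4).1 (by linarith)])
        have f52 := e52 (by linarith)
        have f25 := e25 (by linarith)
        have f53 := e53 ((s _ u1 h1).2 (by linarith))
        have f54 := e54 (by linarith [(s (q-1) u1 h1).2 (by linarith)])
        rcases le_total b a with ab | ab
        · have pq : p ≤ q := by
            by_contra hh
            push Not at hh
            nlinarith [mul_pos hb0 (sub_pos.2 hh), mul_nonneg hp0.le (sub_nonneg.2 ab)]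
          have f31 := e31 (by linarith [(s (1-a) u2 h2).2 (by linarith), (s (b-a) u4 h4).2 (by linarith), (s (1-a) u5 h5).2 (by linarith)])
          have f43 := e43 (by linarith [(s (p-q) u1 h1).2 (by linarith)])
          refine ⟨?_, ?_, ?_, ?_⟩ <;> linarith
        · have pq : q ≤ p := by
            by_contra hh
            push Not at hh
            nlinarith [mul_pos ha (sub_pos.2 hh), mul_nonneg hq0.le (sub_nonneg.2 ab)]
          have f34 := e34 (by linarith [(s (p-q) u1 h1).1 (by linarith)])
          have f41 := e41 (by linarith [(s (1-b) u2 h2).2 (by linarith), (s (a-b) u3 h3).2 (by linarith), (s (1-b) u5 h5).2 (by linarith)])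
          refine ⟨?_, ?_, ?_, ?_⟩ <;> linarith
      · have r1 : 1 ≤ r := by nlinarith
        have f24 := e24 (by
          have : c * q ≤ 1 := by nlinarith
          linarith [(s (1-c*q) u1 h1).1 (by linarith), (s (1-c) u3 h3).1 (by linarith), (s (1-c) u5 h5).1 (by linarith)])
        have f52 := e52 ((s _ u4 h4).2 (by linarith))
        rcases eq_or_lt_of_le a1 with ha1 | ha1
        · subst ha1
          have hp1 : p = 1 := by linarith
          subst hp1
          have f13 := e13 (by linarith [(s (b-1) u4 h4).1 (by linarith)])
          have f35 := e35 (by linarith)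
          have f41 := e41 (by
            have : 1 ≤ b * r := by nlinarith
            linarith [(s (1-b*r) u2 h2).2 (by linarith), (s (1-b) u3 h3).2 (by linarith), (s (1-b) u5 h5).2 (by linarith)])
          refine ⟨?_, ?_, ?_, ?_⟩ <;> linarith
        · have ab : b ≤ a := by
            by_contra hh
            exact hcond.2 ⟨hc1, ha1, not_le.1 hh⟩
          have pq : p ≤ q := by
            by_contra hh
            push Not at hh
            nlinarith [mul_pos hb0 (sub_pos.2 hh), mul_nonneg hp0.le (sub_nonneg.2 ab)]
          have f15 := e15 (by linarith [(s (a-1) u3 h3).1 (by linarith), (s (b-1) u4 h4).1 (by linarith)])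
          have f31 := e31 (by linarith [(s (1-a) u2 h2).2 (by linarith), (s (b-a) u4 h4).2 (by linarith), (s (1-a) u5 h5).2 (by linarith)])
          have f43 := e43 (by linarith [(s (p-q) u1 h1).2 (by linarith), (s (1-r) u2 h2).2 (by linarith)])
          refine ⟨?_, ?_, ?_, ?_⟩ <;> linarith
  · have p1 : 1 ≤ p := by nlinarith
    have ab : a ≤ b := by linarith
    have f13 := e13 (by linarith [(s (1-a) u2 h2).1 (by linarith), (s (b-a) u4 h4).1 (by linarith), (s (1-a) u5 h5).1 (by linarith)])
    have f35 := e35 ((s _ u1 h1).1 (by linarith))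
    rcases le_total 1 c with c1 | c1
    · have r1 : r ≤ 1 := by nlinarith
      have f25 := e25 ((s _ u4 h4).1 (by linarith))
      have f54 := e54 (by linarith [(s (q-1) u1 h1).2 (by linarith), (s (r-1) u2 h2).2 (by linarith)])
      rcases le_total c b with cb | cb
      · have f41 := e41 (by
          have : 1 ≤ b * r := by nlinarith
          linarith [(s (1-b*r) u2 h2).2 (by linarith), (s (a-b) u3 h3).2 (by linarith), (s (1-b) u5 h5).2 (by linarith)])
        have key : t1 ≤ t2 ∨ t3 ≤ t2 ∨ t4 ≤ t2 := by
          by_contra hh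
          push Not at hh
          obtain ⟨n1, n3, n4⟩ := hh
          have m1 : (a - 1) * u3 + (b - c) * u4 < 0 := by
            by_contra hx
            exact absurd (e12 (not_lt.1 hx)) (not_le.2 n1)
          have m3 : 0 < (1 - p) * u1 + (c - 1) * u4 := by
            by_contra hx
            exact absurd (e32 (not_lt.1 hx)) (not_le.2 n3)
          have m4 : 0 < (1 - c * q) * u1 + (1 - c) * u3 + (1 - c) * u5 := by
            by_contra hx
            exact absurd (e42 (not_lt.1 hx)) (not_le.2 n4)
          have g4 : (c - 1) * u3 < (1 - c * q) * u1 := by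
            linarith [(s (1-c) u5 h5).2 (by linarith)]
          have g4' : b * ((c - 1) * u3) < (b - c) * u1 := by
            have := mul_lt_mul_of_pos_left g4 hb0
            have e : b * ((1 - c * q) * u1) = (b - c) * u1 := by linear_combination (-c * u1) * hq
            linarith
          have g4'' : (c - 1) * u3 < (b - c) * u1 := by
            nlinarith [mul_nonneg (sub_nonneg.2 c1) h3]
          have g3 : (1 - a) * u1 ≤ (c - 1) * u4 := by
            have : (1 - a) * u1 ≤ (p - 1) * u1 := by
              have : 1 - a ≤ p - 1 := by nlinarith [sq_nonneg (a - 1)]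
              exact mul_le_mul_of_nonneg_right this h1
            linarith
          have k1 : 0 < 1 - a := by
            rcases eq_or_lt_of_le a1 with h | h
            · rw [h] at m1
              linarith [(s (b-c) u4 h4).1 (by linarith)]
            · linarith
          have z1 := mul_lt_mul_of_pos_left g4'' k1
          have z2 := mul_le_mul_of_nonneg_left g3 (sub_nonneg.2 cb)
          have z3 := mul_le_mul_of_nonneg_left m1.le (sub_nonneg.2 c1)
          linarith
        rcases key with k | k | k <;> refine ⟨?_, ?_, ?_, ?_⟩ <;> linarith
      · have f42 := e42 (by
          have : 1 ≤ c * q := by nlinarith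
          linarith [(s (1-c*q) u1 h1).2 (by linarith), (s (1-c) u3 h3).2 (by linarith), (s (1-c) u5 h5).2 (by linarith)])
        have f21 := e21 (by linarith [(s (a-1) u3 h3).2 (by linarith), (s (b-c) u4 h4).2 (by linarith)])
        refine ⟨?_, ?_, ?_, ?_⟩ <;> linarith
    · have r1 : 1 ≤ r := by nlinarith
      have f24 := e24 (by
        have : c * q ≤ 1 := by nlinarith
        linarith [(s (1-c*q) u1 h1).1 (by linarith), (s (1-c) u3 h3).1 (by linarith), (s (1-c) u5 h5).1 (by linarith)])
      have f52 := e52 ((s _ u4 h4).2 (by linarith))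
      have f41 := e41 (by
        have : 1 ≤ b * r := by nlinarith
        linarith [(s (1-b*r) u2 h2).2 (by linarith), (s (a-b) u3 h3).2 (by linarith), (s (1-b) u5 h5).2 (by linarith)])
      refine ⟨?_, ?_, ?_, ?_⟩ <;> linarith

/-- Lemma l5cainea: sufficiency. -/
theorem coneCols_subset_effSet_five (a13 a14 a24 : ℝ)
    (h13 : 0 < a13) (h24 : 0 < a24) (h14 : 1 ≤ a14)
    (hcond : ¬ (1 < a24 ∧ a24 < a14 ∧ a14 < a13) ∧ ¬ (a24 < 1 ∧ 1 < a13 ∧ a13 < a14)) :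
    ConeCols !![1, 1, a13, a14, 1; 1, 1, 1, a24, 1; 1 / a13, 1, 1, 1, 1; 1 / a14, 1 / a24, 1, 1, 1; 1, 1, 1, 1, 1] ⊆ EffSet !![1, 1, a13, a14, 1; 1, 1, 1, a24, 1; 1 / a13, 1, 1, 1, 1; 1 / a14, 1 / a24, 1, 1, 1; 1, 1, 1, 1, 1] := by
  rintro w ⟨hw0, u, hu, hw⟩
  have h14' : 0 < a14 := by linarith
  obtain ⟨p, hp⟩ : ∃ p, p = 1 / a13 := ⟨_, rfl⟩
  obtain ⟨q, hq⟩ : ∃ q, q = 1 / a14 := ⟨_, rfl⟩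
  obtain ⟨r, hr⟩ : ∃ r, r = 1 / a24 := ⟨_, rfl⟩
  have hp1 : a13 * p = 1 := by rw [hp]; field_simp
  have hq1 : a14 * q = 1 := by rw [hq]; field_simp
  have hr1 : a24 * r = 1 := by rw [hr]; field_simp
  have hp0 : 0 < p := by rw [hp]; positivity
  have hq0 : 0 < q := by rw [hq]; positivity
  have hr0 : 0 < r := by rw [hr]; positivity
  rw [← hp, ← hq, ← hr] at hw
  rw [← hp, ← hq, ← hr]
  have w1 : w 0 = u 0 + u 1 + a13 * u 2 + a14 * u 3 + u 4 := by
    rw [hw]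
    simp [Matrix.mulVec, dotProduct, Fin.sum_univ_five]
  have w2 : w 1 = u 0 + u 1 + u 2 + a24 * u 3 + u 4 := by
    rw [hw]
    simp [Matrix.mulVec, dotProduct, Fin.sum_univ_five]
  have w3 : w 2 = p * u 0 + u 1 + u 2 + u 3 + u 4 := by
    rw [hw]
    simp [Matrix.mulVec, dotProduct, Fin.sum_univ_five]
  have w4 : w 3 = q * u 0 + r * u 1 + u 2 + u 3 + u 4 := by
    rw [hw]
    simp [Matrix.mulVec, dotProduct, Fin.sum_univ_five]
  have w5 : w 4 = u 0 + u 1 + u 2 + u 3 + u 4 := by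
    rw [hw]
    simp [Matrix.mulVec, dotProduct, Fin.sum_univ_five]
  have hpos : ∀ i, 0 < w i := by
    have hne : ∃ k, 0 < u k := by
      by_contra hh
      push Not at hh
      apply hw0
      have : u = 0 := by
        funext k
        exact le_antisymm (hh k) (hu k)
      rw [hw, this, Matrix.mulVec_zero]
    obtain ⟨k, hk⟩ := hne
    intro i
    rw [hw]
    refine Finset.sum_pos' (fun j _ => mul_nonneg ?_ (hu j)) ⟨k, Finset.mem_univ _, mul_pos ?_ hk⟩
    · fin_cases i <;> fin_cases j <;> simp <;> linarith
    · fin_cases i <;> fin_cases k <;> simp <;> linarith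
  refine ⟨hpos, fun v hv H => ?_⟩
  have E : ∀ i j x, x = !![1, 1, a13, a14, 1; 1, 1, 1, a24, 1; p, 1, 1, 1, 1; q, r, 1, 1, 1; 1, 1, 1, 1, 1] i j →
      x * w j ≤ w i → v i / w i ≤ v j / w j := by
    intro i j x hx
    subst hx
    exact edge_le _ _ _ _ _ (hv i) (hv j) (hpos i) (hpos j) (H i j)
  have hu0 := hu 0
  have hu1 := hu 1
  have hu2 := hu 2
  have hu3 := hu 3
  have hu4 := hu 4
  obtain ⟨g1, g2, g3, g4⟩ := core_eq a13 a14 a24 p q r (u 0) (u 1) (u 2) (u 3) (u 4)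
    (v 0 / w 0) (v 1 / w 1) (v 2 / w 2) (v 3 / w 3) (v 4 / w 4) h13 h24 h14 hp1 hq1 hr1 hcond
    hu0 hu1 hu2 hu3 hu4
    (fun h => E 0 1 1 rfl (by
      rw [w1, w2]
      linear_combination h))
    (fun h => E 1 0 1 rfl (by
      rw [w2, w1]
      linear_combination h))
    (fun h => E 0 2 a13 rfl (by
      rw [w1, w3]
      linear_combination h + (u 0) * hp1))
    (fun h => E 2 0 p rfl (by
      have hh : w 0 ≤ a13 * w 2 := by
        rw [w3, w1]
        linear_combination h - (u 0) * hp1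
      have := mul_le_mul_of_nonneg_left hh hp0.le
      linear_combination this + (w 2) * hp1))
    (fun h => E 3 0 q rfl (by
      have hh : w 0 ≤ a14 * w 3 := by
        rw [w4, w1]
        linear_combination h - (u 0) * hq1
      have := mul_le_mul_of_nonneg_left hh hq0.le
      linear_combination this + (w 3) * hq1))
    (fun h => E 0 4 1 rfl (by
      rw [w1, w5]
      linear_combination h))
    (fun h => E 1 2 1 rfl (by
      rw [w2, w3]
      linear_combination h))
    (fun h => E 2 1 1 rfl (by
      rw [w3, w2]
      linear_combination h))
    (fun h => E 1 3 a24 rfl (by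
      rw [w2, w4]
      linear_combination h + (u 1) * hr1))
    (fun h => E 3 1 r rfl (by
      have hh : w 1 ≤ a24 * w 3 := by
        rw [w4, w2]
        linear_combination h - (u 1) * hr1
      have := mul_le_mul_of_nonneg_left hh hr0.le
      linear_combination this + (w 3) * hr1))
    (fun h => E 1 4 1 rfl (by
      rw [w2, w5]
      linear_combination h))
    (fun h => E 4 1 1 rfl (by
      rw [w5, w2]
      linear_combination h))
    (fun h => E 2 3 1 rfl (by
      rw [w3, w4]
      linear_combination h))
    (fun h => E 3 2 1 rfl (by
      rw [w4, w3]
      linear_combination h))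
    (fun h => E 2 4 1 rfl (by
      rw [w3, w5]
      linear_combination h))
    (fun h => E 4 2 1 rfl (by
      rw [w5, w3]
      linear_combination h))
    (fun h => E 4 3 1 rfl (by
      rw [w5, w4]
      linear_combination h))
  refine ⟨v 4 / w 4, ?_⟩
  have G : ∀ i, v i / w i = v 4 / w 4 := by
    intro i
    fin_cases i
    · exact g1
    · exact g2
    · exact g3
    · exact g4
    · rfl
  funext i
  have := G i
  rw [div_eq_iff (hpos i).ne'] at this
  simpa using this
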